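/- Let x* > 0, κ ∈ (0,1) and λ, r > 0 with 0 < λ/r < 1 and r/λ > 1 + ((1 − κ)/κ)·log(1 − κ). Let v, G, c, l, the interval endpoints x̃_j and the functions y_j be as in the recursion of Theorem 4.1 (y₀ = v, y_{j+1}(x̃) = y_j(x̃) + c^{j+1}·∫_{x̃_{j+1}}^{x̃}∫_{x̃_j}^{l(s_{j+1})}⋯∫_{x̃₁}^{l(s₂)} g_{j+1}(x̃,s₁,…,s_{j+1})·v(l(s₁)) ds₁⋯ds_{j+1}), built from fundamental solutions u, v of ℒ[y] = 0 with nonvanishing Wronskian. For any constant A ∈ ℂ define the piecewise function h : (0,∞) → ℂ by h(x̃) = 1 + A·y_j(x̃) for x̃ ∈ [x̃_j, x̃_{j+1}). Then h satisfies the infinitesimal generator equation of the insured process: r(x̃ + x*)·x̃·h'(x̃) − λ(x̃ + x*)·h(x̃) + (λ/κ)·∫_{(x̃ + x*)(1 − κ)}^{x̃ + x*} h(u − x*) du = 0 for all x̃ > x*κ/(1 − κ) with x̃ not an interval endpoint x̃_j, and r(x̃ + x*)·x̃·h'(x̃) − λ(x̃ + x*)·h(x̃) + (λ/κ)·∫_{x*}^{x̃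 + x*} h(u − x*) du + λx* − λ(1 − κ)x̃/κ = 0 for all 0 < x̃ < x*κ/(1 − κ); moreover lim_{x̃→0⁺} h(x̃) = 1. -/

import Mathlib

open MeasureTheory

/-- The Gauss hypergeometric function `₂F₁(a,b;c;w)` with complex parameters, as the sum
of its series `∑ (a)ₙ (b)ₙ / ((c)ₙ n!) wⁿ`, with `(q)ₙ` the rising factorial. -/
noncomputable def hyp2F1C (a b c w : ℂ) : ℂ :=
  ∑' n : ℕ,
    Polynomial.eval a (ascPochhammer ℂ n) * Polynomial.eval b (ascPochhammer ℂ n) /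
      (Polynomial.eval c (ascPochhammer ℂ n) * (Nat.factorial n : ℂ)) * w ^ n

/-- Green's function `G(x,s) = (u(s)v(x) − u(x)v(s))/(s(s+x*)W(s))` of the operator `ℒ`,
where `W = u v' − u' v` is the Wronskian. -/
noncomputable def greensG (xstar : ℝ) (u v : ℝ → ℂ) (x s : ℝ) : ℂ :=
  (u s * v x - u x * v s) /
    (((s * (s + xstar) : ℝ) : ℂ) * (u s * deriv v s - deriv u s * v s))

/-- `l(x) = (1−κ)x − x*κ`. -/
noncomputable def lmap (xstar κ x : ℝ) : ℝ := (1 - κ) * x - xstar * κ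

/-- The interval endpoints `x̃₀ = 0`, `x̃_{j+1} = (x̃_j + x*κ)/(1−κ)`. -/
noncomputable def xpt (xstar κ : ℝ) : ℕ → ℝ
  | 0 => 0
  | j + 1 => (xpt xstar κ j + xstar * κ) / (1 - κ)

/-- The `j`-fold iterated integral
`T_j(x) = ∫_{x̃_j}^{x} ∫_{x̃_{j−1}}^{l(s_j)} ⋯ ∫_{x̃₁}^{l(s₂)} g_j(x,s₁,…,s_j) v(l(s₁)) ds₁⋯ds_j`,
computed innermost-first using the recursive kernels `g₁(x,s₁) = G(x,s₁)`,
`g_{j+1}(x,s₁,…,s_{j+1}) = G(x,s_{j+1}) g_j(l(s_{j+1}),s₁,…,s_j)`; equivalently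
`T₀ = v` and `T_{j+1}(x) = ∫_{x̃_{j+1}}^{x} G(x,s) T_j(l(s)) ds`. -/
noncomputable def iterT (xstar κ : ℝ) (u v : ℝ → ℂ) : ℕ → ℝ → ℂ
  | 0 => v
  | j + 1 => fun x =>
      ∫ s in (xpt xstar κ (j + 1))..x, greensG xstar u v x s * iterT xstar κ u v j (lmap xstar κ s)

/-- The recursion of Theorem 4.1: `y₀ = v`, `y_{j+1}(x̃) = y_j(x̃) + c^{j+1} T_{j+1}(x̃)`. -/
noncomputable def yrec (xstar κ : ℝ) (c : ℂ) (u v : ℝ → ℂ) : ℕ → ℝ → ℂ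
  | 0 => v
  | j + 1 => fun x => yrec xstar κ c u v j x + c ^ (j + 1) * iterT xstar κ u v (j + 1) x

open Filter Topology

/-- If `∑ ‖aₙ‖ρⁿ` converges for every `ρ < 1`, so does the same series for the coefficients of
the derivative. -/
theorem summable_succ_mul_pow {a : ℕ → ℂ}
    (ha : ∀ ρ : ℝ, 0 < ρ → ρ < 1 → Summable fun n => ‖a n‖ * ρ ^ n) (ρ : ℝ) (h0 : 0 < ρ)
    (h1 : ρ < 1) : Summable fun n : ℕ => ‖((n : ℂ) + 1) * a (n + 1)‖ * ρ ^ n := by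
  obtain ⟨σ, hσ, hσ1⟩ := exists_between h1
  have hσ0 : 0 < σ := h0.trans hσ
  have hlim := tendsto_self_mul_const_pow_of_lt_one (r := ρ / σ) (by positivity)
    ((div_lt_one hσ0).2 hσ)
  have hev : ∀ᶠ n : ℕ in atTop, (n : ℝ) * (ρ / σ) ^ n ≤ ρ :=
    (hlim.eventually (gt_mem_nhds h0)).mono fun n hn => hn.le
  have hs := (summable_nat_add_iff 1).2 (ha σ hσ0 hσ1)
  refine hs.of_norm_bounded_eventually_nat ?_
  filter_upwards [(tendsto_add_atTop_nat 1).eventually hev] with n hn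
  rw [Real.norm_of_nonneg (by positivity), norm_mul]
  have e : ‖(n : ℂ) + 1‖ = (n : ℝ) + 1 := by
    rw [← Nat.cast_succ, Complex.norm_natCast, Nat.cast_succ]
  have hk : ((n : ℝ) + 1) * ρ ^ n ≤ σ ^ (n + 1) := by
    push_cast at hn
    rw [div_pow, mul_div_assoc', div_le_iff₀ (by positivity), pow_succ ρ] at hn
    nlinarith
  rw [e]
  calc (n + 1) * ‖a (n + 1)‖ * ρ ^ n = ‖a (n + 1)‖ * ((n + 1) * ρ ^ n) := by ring
    _ ≤ _ := by gcongr

theorem hasDerivAt_tsum_mul_pow {a : ℕ → ℂ}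
    (ha : ∀ ρ : ℝ, 0 < ρ → ρ < 1 → Summable fun n => ‖a n‖ * ρ ^ n) {w : ℂ} (hw : ‖w‖ < 1) :
    HasDerivAt (fun z => ∑' n, a n * z ^ n) (∑' n : ℕ, ((n : ℂ) + 1) * a (n + 1) * w ^ n) w := by
  obtain ⟨ρ, hρ, hρ1⟩ := exists_between hw
  have hρ0 : 0 < ρ := (norm_nonneg w).trans_lt hρ
  have hs := summable_succ_mul_pow ha ρ hρ0 hρ1
  have hs' : Summable fun n : ℕ => ‖(n : ℂ) * a n‖ * ρ ^ (n - 1) := by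
    refine (summable_nat_add_iff 1).1 ?_
    simpa using hs
  have hd := hasDerivAt_tsum_of_isPreconnected (𝕜 := ℂ) (g := fun n z => a n * z ^ n)
    (g' := fun n z => a n * (n * z ^ (n - 1))) (t := Metric.ball 0 ρ) (y₀ := 0) (y := w) hs'
    Metric.isOpen_ball (convex_ball (0 : ℂ) ρ).isPreconnected
    (fun n y _ => (hasDerivAt_pow n y).const_mul _) ?_ (by simpa using hρ0) ?_ (by simpa using hρ)
  · refine hd.congr_deriv ?_
    have hsum : Summable fun n : ℕ => a n * (n * w ^ (n - 1)) := by
      refine hs'.of_norm_bounded fun n => ?_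
      rw [norm_mul, norm_mul, norm_mul, norm_pow, ← mul_assoc, mul_comm ‖a n‖]
      gcongr
    rw [hsum.tsum_eq_zero_add]
    simp only [Nat.cast_zero, zero_mul, mul_zero, zero_add, Nat.add_sub_cancel]
    exact tsum_congr fun n => by push_cast; ring
  · intro n y hy
    rw [norm_mul, norm_mul, norm_mul, norm_pow, ← mul_assoc, mul_comm ‖a n‖]
    have : ‖y‖ ≤ ρ := by simpa using (mem_ball_zero_iff.1 hy).le
    gcongr
  · refine summable_of_ne_finset_zero (s := {0}) fun n hn => ?_
    simp only [Finset.mem_singleton] at hn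
    simp [hn]

theorem summable_mul_pow {a : ℕ → ℂ}
    (ha : ∀ ρ : ℝ, 0 < ρ → ρ < 1 → Summable fun n => ‖a n‖ * ρ ^ n) {w : ℂ} (hw : ‖w‖ < 1) :
    Summable fun n => a n * w ^ n := by
  obtain ⟨ρ, hρ, hρ1⟩ := exists_between hw
  refine (ha ρ ((norm_nonneg w).trans_lt hρ) hρ1).of_norm_bounded fun n => ?_
  rw [norm_mul, norm_pow]
  gcongr

theorem HasSum.mul_pow_shift {b : ℕ → ℂ} {w s : ℂ} (h0 : b 0 = 0)
    (h : HasSum (fun n => b (n + 1) * w ^ n) s) : HasSum (fun n => b n * w ^ n) (w * s) := by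
  rw [← hasSum_nat_add_iff' 1]
  simp only [Finset.range_one, Finset.sum_singleton, h0, zero_mul, sub_zero]
  have e : (fun n => b (n + 1) * w ^ (n + 1)) = fun n => w * (b (n + 1) * w ^ n) := by
    funext n
    ring
  exact e ▸ h.mul_left w

/-- The coefficients of the Gauss hypergeometric series. -/
noncomputable def hypCoeff (a b c : ℂ) (n : ℕ) : ℂ :=
  Polynomial.eval a (ascPochhammer ℂ n) * Polynomial.eval b (ascPochhammer ℂ n) /
    (Polynomial.eval c (ascPochhammer ℂ n) * (Nat.factorial n : ℂ))

theorem hypCoeff_succ (a b : ℂ) {c : ℂ} (hc : ∀ n : ℕ, c + n ≠ 0) (n : ℕ) :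
    hypCoeff a b c (n + 1) * ((n + 1) * (c + n)) = hypCoeff a b c n * ((a + n) * (b + n)) := by
  have h1 : Polynomial.eval c (ascPochhammer ℂ n) ≠ 0 := by
    intro h
    obtain ⟨k, -, hk⟩ := (ascPochhammer_eval_eq_zero_iff n c).1 h
    exact hc k (by rw [hk]; ring)
  have h2 : (n.factorial : ℂ) ≠ 0 := Nat.cast_ne_zero.2 n.factorial_ne_zero
  have h3 : (n : ℂ) + 1 ≠ 0 := Nat.cast_add_one_ne_zero n
  have h4 := hc n
  simp only [hypCoeff, ascPochhammer_succ_eval, Nat.factorial_succ]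
  push_cast
  field_simp

theorem summable_norm_hypCoeff (a b : ℂ) {c : ℂ} (hc : ∀ n : ℕ, c + n ≠ 0) (ρ : ℝ) (h0 : 0 < ρ)
    (h1 : ρ < 1) : Summable fun n => ‖hypCoeff a b c n‖ * ρ ^ n := by
  obtain ⟨σ, hσ, hσ1⟩ := exists_between h1
  have hlim : Tendsto (fun n : ℕ => ‖(a + n) / (1 + n) * ((b + n) / (c + n))‖ * ρ) atTop
      (𝓝 ρ) := by
    have h1 := tendsto_add_mul_div_add_mul_atTop_nhds a (1 : ℂ) (1 : ℂ) one_ne_zero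
    have h2 := tendsto_add_mul_div_add_mul_atTop_nhds b c (1 : ℂ) one_ne_zero
    simpa using ((h1.mul h2).norm.mul_const ρ)
  refine summable_of_ratio_norm_eventually_le hσ1 ?_
  filter_upwards [hlim.eventually (gt_mem_nhds hσ)] with n hn
  have h3 : (n : ℂ) + 1 ≠ 0 := Nat.cast_add_one_ne_zero n
  have h3' : 1 + (n : ℂ) ≠ 0 := by rwa [add_comm]
  have h4 := hc n
  have e : hypCoeff a b c (n + 1) =
      (a + n) / (1 + n) * ((b + n) / (c + n)) * hypCoeff a b c n := by
    have := hypCoeff_succ a b hc n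
    field_simp
    linear_combination this
  rw [e, norm_mul ((a + n) / (1 + n) * ((b + n) / (c + n))), Real.norm_of_nonneg (by positivity),
    Real.norm_of_nonneg (by positivity)]
  calc _ = (‖(a + n) / (1 + n) * ((b + n) / (c + n))‖ * ρ) * (‖hypCoeff a b c n‖ * ρ ^ n) := by
        ring
    _ ≤ _ := by gcongr

/-- On the unit disc `₂F₁` is twice differentiable and satisfies Gauss's equation. -/
theorem exists_hasDerivAt_hyp2F1C (a b : ℂ) {c : ℂ} (hc : ∀ n : ℕ, c + n ≠ 0) :
    ∃ F₁ F₂ : ℂ → ℂ, ∀ w : ℂ, ‖w‖ < 1 → HasDerivAt (hyp2F1C a b c) (F₁ w) w ∧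
      HasDerivAt F₁ (F₂ w) w ∧
      w * (1 - w) * F₂ w + (c - (a + b + 1) * w) * F₁ w - a * b * hyp2F1C a b c w = 0 := by
  have hA := summable_norm_hypCoeff a b hc
  set A := hypCoeff a b c with hAdef
  have hB := summable_succ_mul_pow hA
  have hC := summable_succ_mul_pow hB
  refine ⟨fun w => ∑' n : ℕ, ((n : ℂ) + 1) * A (n + 1) * w ^ n,
    fun w => ∑' n : ℕ, ((n : ℂ) + 1) * (((n + 1 : ℕ) : ℂ) + 1) * A (n + 1 + 1) * w ^ n,
    fun w hw => ⟨hasDerivAt_tsum_mul_pow hA hw, ?_, ?_⟩⟩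
  · simpa only [mul_assoc] using hasDerivAt_tsum_mul_pow hB hw
  · have s0 := (summable_mul_pow hA hw).hasSum
    have s1 := (summable_mul_pow hB hw).hasSum
    have s2 := (summable_mul_pow hC hw).hasSum
    simp only [← mul_assoc] at s2
    have t1 := HasSum.mul_pow_shift (b := fun n => (n : ℂ) * A n) (by simp) (by simpa using s1)
    have t2 := HasSum.mul_pow_shift (b := fun n => (n : ℂ) * ((n + 1) * A (n + 1))) (by simp)
      (by simpa [← mul_assoc] using s2)
    have t3 := HasSum.mul_pow_shift (b := fun n => ((n : ℂ) - 1) * (n * A n)) (by simp)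
      (by simpa [← mul_assoc] using t2)
    have key := ((((t2.sub t3).add (s1.mul_left c)).sub (t1.mul_left (a + b + 1))).sub
      (s0.mul_left (a * b)))
    have e := key.unique (a₂ := 0) (by
      convert! (hasSum_zero : HasSum (fun _ : ℕ => (0 : ℂ)) 0) using 2 with n
      linear_combination w ^ n * hypCoeff_succ a b hc n)
    have e0 : hyp2F1C a b c w = ∑' n, A n * w ^ n := rfl
    rw [e0]
    simp only [← mul_assoc] at e ⊢
    push_cast at e ⊢
    linear_combination e

/-- `y` and `P = x(x + x*)y'` satisfy, on `(0,∞)`, the first-order system equivalent to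
`x(x + x*)y'' + ((2 − q)x + x*(1 − q))y' + c y = f`. -/
def SolvesSystem (xstar q : ℝ) (c : ℂ) (y P f : ℝ → ℂ) : Prop :=
  ∀ x : ℝ, 0 < x → HasDerivAt y (P x / ((x * (x + xstar) : ℝ) : ℂ)) x ∧
    HasDerivAt P ((q : ℂ) / x * P x - c * y x + f x) x

theorem HasDerivAt.ofReal_cpow_const {g : ℝ → ℝ} {g' x : ℝ} (hg : HasDerivAt g g' x)
    (h0 : 0 < g x) (s : ℂ) :
    HasDerivAt (fun t => (g t : ℂ) ^ s) ((g x : ℂ) ^ s * (s * g' / g x)) x := by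
  have hne : (g x : ℂ) ≠ 0 := Complex.ofReal_ne_zero.2 h0.ne'
  have h1 : HasDerivAt (fun z : ℂ => z ^ s) (s * (g x : ℂ) ^ (s - 1) * 1) (g x : ℂ) :=
    (hasDerivAt_id (g x : ℂ)).cpow_const (Complex.ofReal_mem_slitPlane.2 h0)
  refine (h1.comp x hg.ofReal_comp).congr_deriv ?_
  rw [Complex.cpow_sub _ _ hne, Complex.cpow_one]
  ring

theorem norm_ofReal_div_add_lt_one {xstar x : ℝ} (hs : 0 < xstar) (hx : 0 ≤ x) :
    ‖((x / (x + xstar) : ℝ) : ℂ)‖ < 1 := by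
  rw [Complex.norm_real, Real.norm_of_nonneg (by positivity), div_lt_one (by positivity)]
  linarith

theorem hasDerivAt_div_add {xstar x : ℝ} (h : x + xstar ≠ 0) :
    HasDerivAt (fun t : ℝ => t / (t + xstar)) (xstar / (x + xstar) ^ 2) x := by
  refine ((hasDerivAt_id x).div ((hasDerivAt_id x).add_const xstar) h).congr_deriv ?_
  simp

/-- The functions `w^μ (1 + x/x*)^{−a} ₂F₁(μ + a, μ + a; 1 − q + 2μ; w)`, `w = x/(x + x*)`, with
`μ ∈ {0, q}`, solve the homogeneous equation; they vanish at `0` if `Re μ > 0`. -/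
theorem exists_solvesSystem_hyp2F1C {xstar q : ℝ} (hs : 0 < xstar) {c a μ : ℂ}
    (hμ : μ * (μ - q) = 0) (ha : a ^ 2 - a * (1 - q) + c = 0) (hγ : ∀ n : ℕ, 1 - q + 2 * μ + n ≠ 0)
    {y : ℝ → ℂ}
    (hy : ∀ x > (0 : ℝ), y x = ((x / (x + xstar) : ℝ) : ℂ) ^ μ * ((1 + x / xstar : ℝ) : ℂ) ^ (-a) *
      hyp2F1C (μ + a) (μ + a) (1 - q + 2 * μ) ((x / (x + xstar) : ℝ) : ℂ)) :
    ∃ P : ℝ → ℂ, SolvesSystem xstar q c y P 0 ∧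
      (0 < μ.re → Tendsto y (𝓝[>] 0) (𝓝 0) ∧ Tendsto P (𝓝[>] 0) (𝓝 0)) := by
  obtain ⟨F₁, F₂, hF⟩ := exists_hasDerivAt_hyp2F1C (μ + a) (μ + a) hγ
  set F := hyp2F1C (μ + a) (μ + a) (1 - q + 2 * μ) with hFdef
  set M : ℝ → ℂ := fun x => ((x / (x + xstar) : ℝ) : ℂ) ^ μ * ((1 + x / xstar : ℝ) : ℂ) ^ (-a)
    with hM
  set N : ℝ → ℂ := fun x => (μ * xstar - a * x) * F ((x / (x + xstar) : ℝ) : ℂ) +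
    xstar * ((x / (x + xstar) : ℝ) : ℂ) * F₁ ((x / (x + xstar) : ℝ) : ℂ) with hN
  have hdF : ∀ x : ℝ, 0 ≤ x → HasDerivAt (fun t : ℝ => F ((t / (t + xstar) : ℝ) : ℂ))
      (F₁ ((x / (x + xstar) : ℝ) : ℂ) * ((xstar / (x + xstar) ^ 2 : ℝ) : ℂ)) x := fun x hx =>
    (hF _ (norm_ofReal_div_add_lt_one hs hx)).1.comp (h := fun t : ℝ => ((t / (t + xstar) : ℝ) : ℂ))
      x (hasDerivAt_div_add (by positivity)).ofReal_comp
  have hdF₁ : ∀ x : ℝ, 0 ≤ x → HasDerivAt (fun t : ℝ => F₁ ((t / (t + xstar) : ℝ) : ℂ))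
      (F₂ ((x / (x + xstar) : ℝ) : ℂ) * ((xstar / (x + xstar) ^ 2 : ℝ) : ℂ)) x := fun x hx =>
    (hF _ (norm_ofReal_div_add_lt_one hs hx)).2.1.comp
      (h := fun t : ℝ => ((t / (t + xstar) : ℝ) : ℂ)) x
      (hasDerivAt_div_add (by positivity)).ofReal_comp
  have hdM : ∀ x : ℝ, 0 < x → HasDerivAt M
      (M x * ((μ * xstar - a * x) / (x * (x + xstar)))) x := by
    intro x hx
    have h1 := (hasDerivAt_div_add (xstar := xstar) (x := x) (by positivity)).ofReal_cpow_const
      (by positivity) μ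
    have h2 := (((hasDerivAt_id x).div_const xstar).const_add 1).ofReal_cpow_const
      (by simp only [id]; positivity) (-a)
    refine (h1.mul h2).congr_deriv ?_
    have e1 : (x : ℂ) ≠ 0 := Complex.ofReal_ne_zero.2 hx.ne'
    have e2 : (xstar : ℂ) ≠ 0 := Complex.ofReal_ne_zero.2 hs.ne'
    have e3 : (x : ℂ) + xstar ≠ 0 := by
      rw [← Complex.ofReal_add]; exact Complex.ofReal_ne_zero.2 (by positivity)
    have e4 : 1 + (x : ℂ) / xstar ≠ 0 := by
      have : 1 + (x : ℂ) / xstar = (x + xstar) / xstar := by field_simp; ring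
      rw [this]; exact div_ne_zero e3 e2
    simp only [hM, id]
    generalize ((x / (x + xstar) : ℝ) : ℂ) ^ μ = A
    generalize ((1 + x / xstar : ℝ) : ℂ) ^ (-a) = B
    push_cast
    have e5 : (xstar : ℂ) + x ≠ 0 := by rwa [add_comm]
    field_simp
    ring
  refine ⟨fun x => M x * N x, fun x hx => ⟨?_, ?_⟩, fun hre => ?_⟩
  · have hd : HasDerivAt (fun t : ℝ => M t * F ((t / (t + xstar) : ℝ) : ℂ)) _ x :=
      (hdM x hx).mul (hdF x hx.le)
    have he : y =ᶠ[𝓝 x] fun t : ℝ => M t * F ((t / (t + xstar) : ℝ) : ℂ) := by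
      filter_upwards [lt_mem_nhds hx] with t ht
      exact hy t ht
    refine (hd.congr_of_eventuallyEq he).congr_deriv ?_
    have e1 : (x : ℂ) ≠ 0 := Complex.ofReal_ne_zero.2 hx.ne'
    have e3 : (x : ℂ) + xstar ≠ 0 := by
      rw [← Complex.ofReal_add]; exact Complex.ofReal_ne_zero.2 (by positivity)
    simp only [hN]
    generalize M x = A
    generalize F ((x / (x + xstar) : ℝ) : ℂ) = f0
    generalize F₁ ((x / (x + xstar) : ℝ) : ℂ) = f1
    push_cast
    field_simp
  · have hX : HasDerivAt (fun t : ℝ => (t : ℂ)) 1 x := by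
      simpa using (hasDerivAt_id x).ofReal_comp
    have hw : HasDerivAt (fun t : ℝ => ((t / (t + xstar) : ℝ) : ℂ)) _ x :=
      (hasDerivAt_div_add (xstar := xstar) (x := x) (by positivity)).ofReal_comp
    have hd : HasDerivAt (fun t : ℝ => M t * N t) _ x :=
      (hdM x hx).mul ((((hX.const_mul a).const_sub (μ * xstar)).mul (hdF x hx.le)).add
        ((hw.const_mul (xstar : ℂ)).mul (hdF₁ x hx.le)))
    refine hd.congr_deriv ?_
    have ode := (hF _ (norm_ofReal_div_add_lt_one hs hx.le)).2.2
    have e1 : (x : ℂ) ≠ 0 := Complex.ofReal_ne_zero.2 hx.ne'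
    have e3 : (x : ℂ) + xstar ≠ 0 := by
      rw [← Complex.ofReal_add]; exact Complex.ofReal_ne_zero.2 (by positivity)
    rw [hy x hx]
    change _ = (q : ℂ) / x * (M x * N x) - c * (M x * F ((x / (x + xstar) : ℝ) : ℂ)) + 0
    simp only [hN]
    generalize M x = A
    generalize F ((x / (x + xstar) : ℝ) : ℂ) = f0 at ode ⊢
    generalize F₁ ((x / (x + xstar) : ℝ) : ℂ) = f1 at ode ⊢
    generalize F₂ ((x / (x + xstar) : ℝ) : ℂ) = f2 at ode ⊢
    push_cast at ode ⊢
    field_simp at ode ⊢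
    linear_combination A * x * xstar * ode +
      A * f0 * (x + xstar) ^ 3 * (xstar * hμ + x * ha)
  · have hw : ContinuousAt (fun t : ℝ => t / (t + xstar)) 0 :=
      (hasDerivAt_div_add (by simpa using hs.ne')).continuousAt
    have hM0 : ContinuousAt M 0 := by
      refine ContinuousAt.mul ?_ ?_
      · exact ContinuousAt.comp (g := fun t : ℝ => (t : ℂ) ^ μ)
          (Complex.continuousAt_ofReal_cpow_const _ _ (Or.inl hre)) hw
      · exact ContinuousAt.comp (f := fun t : ℝ => 1 + t / xstar) (g := fun t : ℝ => (t : ℂ) ^ (-a))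
          (Complex.continuousAt_ofReal_cpow_const _ _ (Or.inr (by simp))) (by fun_prop)
    have hM00 : M 0 = 0 := by
      have : μ ≠ 0 := by rintro rfl; simp at hre
      simp [hM, this]
    have hcF := (hdF 0 le_rfl).continuousAt
    have hcF₁ := (hdF₁ 0 le_rfl).continuousAt
    have hcN : ContinuousAt N 0 :=
      (ContinuousAt.mul (by fun_prop) hcF).add
        ((continuousAt_const.mul (Complex.continuous_ofReal.continuousAt.comp hw)).mul hcF₁)
    constructor
    · have h1 := (hM0.mul hcF).tendsto.mono_left (nhdsWithin_le_nhds (s := Set.Ioi (0 : ℝ)))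
      rw [Pi.mul_apply, hM00, zero_mul] at h1
      refine h1.congr' ?_
      filter_upwards [self_mem_nhdsWithin] with t ht
      exact (hy t ht).symm
    · have h1 := (hM0.mul hcN).tendsto.mono_left (nhdsWithin_le_nhds (s := Set.Ioi (0 : ℝ)))
      rwa [Pi.mul_apply, hM00, zero_mul] at h1

theorem SolvesSystem.continuousAt {xstar q : ℝ} {c : ℂ} {y P f : ℝ → ℂ}
    (h : SolvesSystem xstar q c y P f) {x : ℝ} (hx : 0 < x) : ContinuousAt y x :=
  (h x hx).1.continuousAt

theorem SolvesSystem.congr {xstar q : ℝ} {c : ℂ} {y z P f : ℝ → ℂ}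
    (h : SolvesSystem xstar q c y P f) (hz : ∀ x > 0, z x = y x) :
    SolvesSystem xstar q c z P f := by
  intro x hx
  refine ⟨(h x hx).1.congr_of_eventuallyEq ?_, hz x hx ▸ (h x hx).2⟩
  filter_upwards [lt_mem_nhds hx] with t ht using hz t ht

/-- Variation of parameters with the Green's function of the operator. -/
theorem SolvesSystem.exists_integral_greensG {xstar q : ℝ} (hs : 0 < xstar) {c : ℂ}
    {u v Pu Pv : ℝ → ℂ} (hu : SolvesSystem xstar q c u Pu 0) (hv : SolvesSystem xstar q c v Pv 0)
    (hW : ∀ x > (0 : ℝ), u x * deriv v x - deriv u x * v x ≠ 0) {f : ℝ → ℂ} (hf : Continuous f)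
    {a : ℝ} (ha : 0 < a) :
    ∃ P, SolvesSystem xstar q c (fun x => ∫ s in a..x, greensG xstar u v x s * f s) P f := by
  set k : ℝ → ℂ := fun s => (((s * (s + xstar) : ℝ) : ℂ) * (u s * deriv v s - deriv u s * v s))⁻¹
    with hk
  have hp : ∀ s : ℝ, 0 < s → ((s * (s + xstar) : ℝ) : ℂ) ≠ 0 := fun s h =>
    Complex.ofReal_ne_zero.2 (by positivity)
  have hden : ∀ s : ℝ, 0 < s → ((s * (s + xstar) : ℝ) : ℂ) * (u s * deriv v s - deriv u s * v s) =
      u s * Pv s - Pu s * v s := by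
    intro s h
    have := hp s h
    rw [(hu s h).1.deriv, (hv s h).1.deriv]
    field_simp
  have hne : ∀ s : ℝ, 0 < s → u s * Pv s - Pu s * v s ≠ 0 := fun s h =>
    hden s h ▸ mul_ne_zero (hp s h) (hW s h)
  have hkc : ContinuousOn k (Set.Ioi 0) := by
    have : ContinuousOn (fun s => (u s * Pv s - Pu s * v s)⁻¹) (Set.Ioi 0) := by
      intro s h
      refine ContinuousAt.continuousWithinAt (ContinuousAt.inv₀ ?_ (hne s h))
      exact ((hu s h).1.continuousAt.mul (hv s h).2.continuousAt).sub
        ((hu s h).2.continuousAt.mul (hv s h).1.continuousAt)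
    refine this.congr fun s h => ?_
    rw [hk]
    exact congrArg _ (hden s h)
  have hkey : ∀ g : ℝ → ℂ, ContinuousOn g (Set.Ioi 0) →
      (∀ x > 0, IntervalIntegrable (fun s => k s * g s * f s) volume a x) ∧
      ∀ x > 0, HasDerivAt (fun x => ∫ s in a..x, k s * g s * f s) (k x * g x * f x) x := by
    intro g hg
    have hc : ContinuousOn (fun s => k s * g s * f s) (Set.Ioi 0) :=
      (hkc.mul hg).mul hf.continuousOn
    have hi : ∀ x > 0, IntervalIntegrable (fun s => k s * g s * f s) volume a x := fun x hx =>
      (hc.mono fun t ht => (lt_min ha hx).trans_le ht.1).intervalIntegrable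
    exact ⟨hi, fun x hx => intervalIntegral.integral_hasDerivAt_right (hi x hx)
      (hc.stronglyMeasurableAtFilter isOpen_Ioi x hx) (hc.continuousAt (Ioi_mem_nhds hx))⟩
  obtain ⟨hi1, hd1⟩ := hkey u fun x hx => (hu.continuousAt hx).continuousWithinAt
  obtain ⟨hi2, hd2⟩ := hkey v fun x hx => (hv.continuousAt hx).continuousWithinAt
  set I₁ : ℝ → ℂ := fun x => ∫ s in a..x, k s * u s * f s with hI1
  set I₂ : ℝ → ℂ := fun x => ∫ s in a..x, k s * v s * f s with hI2
  have hsol : SolvesSystem xstar q c (fun x => v x * I₁ x - u x * I₂ x)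
      (fun x => Pv x * I₁ x - Pu x * I₂ x) f := by
    intro x hx
    have hn := hne x hx
    have hkx : k x = (u x * Pv x - Pu x * v x)⁻¹ := congrArg (·⁻¹) (hden x hx)
    constructor
    · refine (((hv x hx).1.mul (hd1 x hx)).sub ((hu x hx).1.mul (hd2 x hx))).congr_deriv ?_
      ring
    · refine (((hv x hx).2.mul (hd1 x hx)).sub ((hu x hx).2.mul (hd2 x hx))).congr_deriv ?_
      have : k x * (u x * Pv x - Pu x * v x) = 1 := by rw [hkx, inv_mul_cancel₀ hn]
      simp only [Pi.zero_apply]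
      linear_combination f x * this
  refine ⟨_, hsol.congr fun x hx => ?_⟩
  rw [hI1, hI2, ← intervalIntegral.integral_const_mul, ← intervalIntegral.integral_const_mul,
    ← intervalIntegral.integral_sub ((hi1 x hx).const_mul _) ((hi2 x hx).const_mul _)]
  refine intervalIntegral.integral_congr fun s _ => ?_
  simp only [greensG, hk, div_eq_mul_inv]
  ring

theorem continuous_of_eq_zero_of_tendsto {g : ℝ → ℂ} (h0 : ∀ x ≤ 0, g x = 0)
    (h1 : ∀ x > 0, ContinuousAt g x) (h2 : Tendsto g (𝓝[>] 0) (𝓝 0)) : Continuous g := by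
  refine continuous_iff_continuousAt.2 fun x => ?_
  rcases lt_trichotomy x 0 with hx | rfl | hx
  · refine (continuousAt_const (y := (0 : ℂ))).congr ?_
    filter_upwards [gt_mem_nhds hx] with t ht using (h0 t ht.le).symm
  · refine continuousAt_iff_continuous_left'_right'.2 ⟨?_, ?_⟩
    · refine (continuousWithinAt_const (b := (0 : ℂ))).congr (fun t ht => h0 t (le_of_lt ht)) ?_
      exact h0 0 le_rfl
    · rw [ContinuousWithinAt, h0 0 le_rfl]
      exact h2
  · exact h1 x hx

section endpoints

variable {xstar κ : ℝ}

theorem lmap_xpt_succ (hκ : κ < 1) (j : ℕ) :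
    lmap xstar κ (xpt xstar κ (j + 1)) = xpt xstar κ j := by
  have : 1 - κ ≠ 0 := (sub_pos.2 hκ).ne'
  rw [lmap, xpt]
  field_simp
  ring

theorem lmap_strictMono (hκ : κ < 1) : StrictMono (lmap xstar κ) := fun x y h => by
  unfold lmap
  have := mul_lt_mul_of_pos_left h (sub_pos.2 hκ)
  linarith

theorem lmap_lt_xpt_iff (hκ : κ < 1) {j : ℕ} {x : ℝ} :
    lmap xstar κ x < xpt xstar κ j ↔ x < xpt xstar κ (j + 1) := by
  rw [← lmap_xpt_succ hκ, (lmap_strictMono hκ).lt_iff_lt]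

theorem lmap_le_xpt_iff (hκ : κ < 1) {j : ℕ} {x : ℝ} :
    lmap xstar κ x ≤ xpt xstar κ j ↔ x ≤ xpt xstar κ (j + 1) := by
  rw [← lmap_xpt_succ hκ, (lmap_strictMono hκ).le_iff_le]

theorem le_xpt (hs : 0 < xstar) (hκ : κ ∈ Set.Ioo (0 : ℝ) 1) (j : ℕ) :
    j * (xstar * κ) ≤ xpt xstar κ j := by
  have h1 : 0 < 1 - κ := sub_pos.2 hκ.2
  have h2 : 0 < xstar * κ := mul_pos hs hκ.1
  induction j with
  | zero => simp [xpt]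
  | succ j ih =>
    rw [xpt, le_div_iff₀ h1]
    have : 0 ≤ (j : ℝ) * (xstar * κ) := by positivity
    push_cast
    nlinarith [mul_nonneg (add_nonneg this h2.le) hκ.1.le]

theorem xpt_strictMono (hs : 0 < xstar) (hκ : κ ∈ Set.Ioo (0 : ℝ) 1) :
    StrictMono (xpt xstar κ) := by
  refine strictMono_nat_of_lt_succ fun j => ?_
  have h1 : 0 < 1 - κ := sub_pos.2 hκ.2
  have h2 : 0 < xstar * κ := mul_pos hs hκ.1
  have h3 : 0 ≤ xpt xstar κ j := le_trans (by positivity) (le_xpt hs hκ j)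
  rw [xpt, lt_div_iff₀ h1]
  nlinarith [mul_nonneg h3 hκ.1.le]

theorem xpt_nonneg (hs : 0 < xstar) (hκ : κ ∈ Set.Ioo (0 : ℝ) 1) (j : ℕ) :
    0 ≤ xpt xstar κ j :=
  (xpt_strictMono hs hκ).monotone j.zero_le

theorem exists_lt_xpt_succ (hs : 0 < xstar) (hκ : κ ∈ Set.Ioo (0 : ℝ) 1) (x : ℝ) :
    ∃ j, x < xpt xstar κ (j + 1) := by
  obtain ⟨n, hn⟩ := exists_nat_gt (x / (xstar * κ))
  rw [div_lt_iff₀ (mul_pos hs hκ.1)] at hn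
  exact ⟨n, (hn.trans_le (le_xpt hs hκ n)).trans (xpt_strictMono hs hκ n.lt_succ_self)⟩

theorem exists_mem_Ico_xpt (hs : 0 < xstar) (hκ : κ ∈ Set.Ioo (0 : ℝ) 1) {x : ℝ}
    (hx : 0 ≤ x) :
    ∃ j, x ∈ Set.Ico (xpt xstar κ j) (xpt xstar κ (j + 1)) := by
  classical
  have h := exists_lt_xpt_succ hs hκ x
  refine ⟨Nat.find h, ?_, Nat.find_spec h⟩
  rcases Nat.eq_zero_or_pos (Nat.find h) with h0 | h0
  · rw [h0]
    exact hx
  · obtain ⟨m, hm⟩ := Nat.exists_eq_add_one_of_ne_zero h0.ne'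
    rw [hm]
    exact not_lt.1 (Nat.find_min h (by omega))

end endpoints

/-- The iterated integral `T_j`, extended by zero to the left of the endpoint `x̃_j`. -/
noncomputable def truncT (xstar κ : ℝ) (u v : ℝ → ℂ) (j : ℕ) : ℝ → ℂ :=
  (Set.Ioi (xpt xstar κ j)).indicator (iterT xstar κ u v j)

theorem truncT_of_le {xstar κ : ℝ} (u v : ℝ → ℂ) {j : ℕ} {x : ℝ} (h : x ≤ xpt xstar κ j) :
    truncT xstar κ u v j x = 0 :=
  Set.indicator_of_notMem (by simpa using h) _

theorem truncT_of_lt {xstar κ : ℝ} (u v : ℝ → ℂ) {j : ℕ} {x : ℝ} (h : xpt xstar κ j < x) :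
    truncT xstar κ u v j x = iterT xstar κ u v j x :=
  Set.indicator_of_mem h _

theorem truncT_succ {xstar κ : ℝ} (hs : 0 < xstar) (hκ : κ ∈ Set.Ioo (0 : ℝ) 1) (u v : ℝ → ℂ)
    (j : ℕ) (x : ℝ) :
    truncT xstar κ u v (j + 1) x = ∫ s in (xpt xstar κ 1)..x,
      greensG xstar u v x s * truncT xstar κ u v j (lmap xstar κ s) := by
  have hzero : ∀ s ≤ xpt xstar κ (j + 1),
      greensG xstar u v x s * truncT xstar κ u v j (lmap xstar κ s) = 0 := fun s hs' => by
    rw [truncT_of_le u v ((lmap_le_xpt_iff hκ.2).2 hs'), mul_zero]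
  have hle : xpt xstar κ 1 ≤ xpt xstar κ (j + 1) :=
    (xpt_strictMono hs hκ).monotone (by omega)
  rcases le_or_gt x (xpt xstar κ (j + 1)) with hx | hx
  · rw [truncT_of_le u v hx, ← intervalIntegral.integral_zero (a := xpt xstar κ 1) (b := x)]
    refine intervalIntegral.integral_congr fun s hs' => ?_
    exact (hzero s (hs'.2.trans (max_le hle hx))).symm
  · rw [truncT_of_lt u v hx, intervalIntegral.integral_of_le (hle.trans hx.le),
      setIntegral_eq_of_subset_of_forall_sdiff_eq_zero measurableSet_Ioc
        (Set.Ioc_subset_Ioc_left hle), iterT]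
    · simp only [intervalIntegral.integral_of_le hx.le]
      refine setIntegral_congr_fun measurableSet_Ioc fun s hs' => ?_
      simp only [truncT_of_lt u v (lmap_xpt_succ hκ.2 j ▸ lmap_strictMono hκ.2 hs'.1)]
    · rintro s ⟨h1, h2⟩
      exact hzero s (not_lt.1 fun h => h2 ⟨h, h1.2⟩)

section renewal

variable {xstar κ : ℝ} {u v : ℝ → ℂ}

/-- Each truncated iterated integral is a continuous function on the line and solves the
inhomogeneous equation whose right-hand side is its predecessor composed with `l`. -/
theorem exists_solvesSystem_truncT (hs : 0 < xstar) (hκ : κ ∈ Set.Ioo (0 : ℝ) 1) {q : ℝ} {c : ℂ}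
    {Pu Pv : ℝ → ℂ} (hu : SolvesSystem xstar q c u Pu 0) (hv : SolvesSystem xstar q c v Pv 0)
    (hW : ∀ x > (0 : ℝ), u x * deriv v x - deriv u x * v x ≠ 0)
    (hv0 : Tendsto v (𝓝[>] 0) (𝓝 0)) (hPv0 : Tendsto Pv (𝓝[>] 0) (𝓝 0)) :
    (∃ P, SolvesSystem xstar q c (truncT xstar κ u v 0) P 0 ∧ Tendsto P (𝓝[>] 0) (𝓝 0)) ∧
    (∀ j, ∃ P, SolvesSystem xstar q c (truncT xstar κ u v (j + 1)) P
      (fun x => truncT xstar κ u v j (lmap xstar κ x)) ∧ Tendsto P (𝓝[>] 0) (𝓝 0)) ∧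
    ∀ j, Continuous (truncT xstar κ u v j) := by
  have h0 : ∀ x > 0, truncT xstar κ u v 0 x = v x := fun x hx => truncT_of_lt u v hx
  have hx1 : 0 < xpt xstar κ 1 := xpt_strictMono hs hκ Nat.zero_lt_one
  have hstep : ∀ j, Continuous (truncT xstar κ u v j) →
      (∃ P, SolvesSystem xstar q c (truncT xstar κ u v (j + 1)) P
        (fun x => truncT xstar κ u v j (lmap xstar κ x)) ∧ Tendsto P (𝓝[>] 0) (𝓝 0)) ∧
      Continuous (truncT xstar κ u v (j + 1)) := by
    intro j hj
    have hzero : ∀ x < xpt xstar κ 1, truncT xstar κ u v (j + 1) x = 0 := fun x hx =>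
      truncT_of_le u v (hx.le.trans ((xpt_strictMono hs hκ).monotone (by omega)))
    obtain ⟨P, hP⟩ := hu.exists_integral_greensG hs hv hW
      (f := fun x => truncT xstar κ u v j (lmap xstar κ x))
      (hj.comp (by unfold lmap; fun_prop)) hx1
    simp only [← truncT_succ hs hκ] at hP
    refine ⟨⟨P, hP, ?_⟩, continuous_of_eq_zero_of_tendsto (fun x hx => hzero x (by linarith))
      (fun x hx => hP.continuousAt hx) ?_⟩
    · refine tendsto_const_nhds.congr' ?_
      filter_upwards [Ioo_mem_nhdsGT hx1] with x hx
      have h1 : HasDerivAt (truncT xstar κ u v (j + 1)) 0 x := by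
        refine (hasDerivAt_const x (0 : ℂ)).congr_of_eventuallyEq ?_
        filter_upwards [gt_mem_nhds hx.2] with t ht using hzero t ht
      have h2 : ((x * (x + xstar) : ℝ) : ℂ) ≠ 0 := by
        have := hx.1
        exact Complex.ofReal_ne_zero.2 (by positivity)
      exact (div_eq_zero_iff.1 ((hP x hx.1).1.unique h1)).resolve_right h2 |>.symm
    · refine tendsto_const_nhds.congr' ?_
      filter_upwards [Ioo_mem_nhdsGT hx1] with x hx using (hzero x hx.2).symm
  have hc : ∀ j, Continuous (truncT xstar κ u v j) := by
    intro j
    induction j with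
    | zero =>
      refine continuous_of_eq_zero_of_tendsto (fun x hx => truncT_of_le u v hx)
        (fun x hx => (hv.congr h0).continuousAt hx) (hv0.congr' ?_)
      filter_upwards [self_mem_nhdsWithin] with x hx using (h0 x hx).symm
    | succ j ih => exact (hstep j ih).2
  exact ⟨⟨Pv, hv.congr h0, hPv0⟩, fun j => (hstep j (hc j)).1, hc⟩

/-- Integrated form of the inhomogeneous equation. -/
theorem SolvesSystem.integral_eq (hs : 0 < xstar) {lam r : ℝ} (hr : r ≠ 0) (hκ : κ ≠ 0)
    {y P f : ℝ → ℂ}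
    (h : SolvesSystem xstar (lam / r) ((lam * (1 - κ) / (r * κ) : ℝ) : ℂ) y P f)
    (hy : Continuous y) (hf : Continuous f) (hy0 : y 0 = 0) (hP : Tendsto P (𝓝[>] 0) (𝓝 0))
    {x : ℝ} (hx : 0 < x) :
    r * P x - lam * (x + xstar) * y x + lam / κ * ∫ t in (0 : ℝ)..x, y t =
      r * ∫ t in (0 : ℝ)..x, f t := by
  have hr' : (r : ℂ) ≠ 0 := Complex.ofReal_ne_zero.2 hr
  have hκ' : (κ : ℂ) ≠ 0 := Complex.ofReal_ne_zero.2 hκ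
  have hd : ∀ t : ℝ, 0 < t → HasDerivAt (fun t : ℝ => r * P t - lam * (t + xstar) * y t)
      (r * f t - lam / κ * y t) t := by
    intro t ht
    have hT : HasDerivAt (fun t : ℝ => (lam : ℂ) * (t + xstar)) (lam * 1) t :=
      (((hasDerivAt_id t).ofReal_comp).add_const (xstar : ℂ)).const_mul (lam : ℂ)
    refine (((h t ht).2.const_mul (r : ℂ)).sub (hT.mul (h t ht).1)).congr_deriv ?_
    have e1 : (t : ℂ) ≠ 0 := Complex.ofReal_ne_zero.2 ht.ne'
    have e3 : (t : ℂ) + xstar ≠ 0 := by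
      rw [← Complex.ofReal_add]; exact Complex.ofReal_ne_zero.2 (by positivity)
    push_cast
    field_simp
    ring
  have hyt : Tendsto y (𝓝[>] 0) (𝓝 0) := by
    have := hy.continuousAt (x := 0)
    rw [ContinuousAt, hy0] at this
    exact this.mono_left nhdsWithin_le_nhds
  have ha : Tendsto (fun t : ℝ => r * P t - lam * (t + xstar) * y t) (𝓝[>] 0) (𝓝 0) := by
    have h1 : Tendsto (fun t : ℝ => (lam : ℂ) * (t + xstar)) (𝓝[>] 0) (𝓝 (lam * ((0 : ℝ) + xstar))) :=
      (Continuous.tendsto (by fun_prop) 0).mono_left nhdsWithin_le_nhds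
    simpa using (hP.const_mul (r : ℂ)).sub (h1.mul hyt)
  have hi1 : IntervalIntegrable (fun t => r * f t) volume 0 x :=
    (hf.const_mul _).intervalIntegrable 0 x
  have hi2 : IntervalIntegrable (fun t => lam / κ * y t) volume 0 x :=
    (hy.const_mul _).intervalIntegrable 0 x
  have key := intervalIntegral.integral_eq_sub_of_hasDerivAt_of_tendsto hx
    (fun t ht => hd t ht.1) (hi1.sub hi2) ha
    ((hd x hx).continuousAt.tendsto.mono_left nhdsWithin_le_nhds)
  rw [intervalIntegral.integral_sub hi1 hi2, intervalIntegral.integral_const_mul,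
    intervalIntegral.integral_const_mul] at key
  linear_combination -key

/-- The partial sums `∑_{i<n} cⁱ Tᵢ` of truncated iterated integrals. -/
noncomputable def truncSum (xstar κ : ℝ) (c : ℂ) (u v : ℝ → ℂ) (n : ℕ) (x : ℝ) : ℂ :=
  ∑ i ∈ Finset.range n, c ^ i * truncT xstar κ u v i x

theorem truncSum_succ (c : ℂ) (n : ℕ) (x : ℝ) : truncSum xstar κ c u v (n + 1) x =
    truncSum xstar κ c u v n x + c ^ n * truncT xstar κ u v n x :=
  Finset.sum_range_succ _ _

theorem truncSum_of_nonpos (hs : 0 < xstar) (hκ : κ ∈ Set.Ioo (0 : ℝ) 1) (c : ℂ) (n : ℕ) {x : ℝ}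
    (hx : x ≤ 0) : truncSum xstar κ c u v n x = 0 :=
  Finset.sum_eq_zero fun i _ => by
    rw [truncT_of_le u v (hx.trans (xpt_nonneg hs hκ i)), mul_zero]

theorem truncSum_eq_of_le (hs : 0 < xstar) (hκ : κ ∈ Set.Ioo (0 : ℝ) 1) (c : ℂ) {m n : ℕ}
    (hmn : m ≤ n) {x : ℝ} (hx : x ≤ xpt xstar κ m) :
    truncSum xstar κ c u v n x = truncSum xstar κ c u v m x := by
  refine (Finset.sum_subset (Finset.range_mono hmn) fun i _ hi => ?_).symm
  have : m ≤ i := by simpa using hi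
  rw [truncT_of_le u v (hx.trans ((xpt_strictMono hs hκ).monotone this)), mul_zero]

theorem yrec_eq_truncSum (hs : 0 < xstar) (hκ : κ ∈ Set.Ioo (0 : ℝ) 1) (c : ℂ) (j : ℕ) {x : ℝ}
    (hx : 0 < x) (hj : xpt xstar κ j ≤ x) :
    yrec xstar κ c u v j x = truncSum xstar κ c u v (j + 1) x := by
  induction j with
  | zero => simp [truncSum, yrec, truncT_of_lt u v (j := 0) hx, iterT]
  | succ j ih =>
    rw [yrec, truncSum_succ, ← ih ((xpt_strictMono hs hκ j.lt_succ_self).le.trans hj)]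
    rcases hj.eq_or_lt with h | h
    · subst h
      simp only [truncT_of_le u v le_rfl, iterT, intervalIntegral.integral_same]
    · rw [truncT_of_lt u v h]

theorem integral_comp_lmap_of_nonpos (hs : 0 < xstar) (hκ : κ ∈ Set.Ioo (0 : ℝ) 1) {g : ℝ → ℂ}
    (hg : Continuous g) (hg0 : ∀ x ≤ 0, g x = 0) (x : ℝ) :
    ∫ t in (0 : ℝ)..x, g (lmap xstar κ t) =
      ((1 - κ : ℝ) : ℂ)⁻¹ * ∫ t in (0 : ℝ)..lmap xstar κ x, g t := by
  unfold lmap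
  rw [intervalIntegral.integral_comp_mul_sub _ (sub_pos.2 hκ.2).ne',
    ← intervalIntegral.integral_add_adjacent_intervals (b := 0) (hg.intervalIntegrable _ _)
      (hg.intervalIntegrable _ _), Complex.real_smul, Complex.ofReal_inv]
  have hneg : (1 - κ) * 0 - xstar * κ ≤ 0 := by
    have := mul_pos hs hκ.1
    linarith
  have : ∫ t in ((1 - κ) * 0 - xstar * κ)..(0 : ℝ), g t = 0 := by
    refine (intervalIntegral.integral_congr (g := fun _ => 0) fun t ht => hg0 t ?_).trans
      intervalIntegral.integral_zero
    rw [Set.uIcc_of_le hneg] at ht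
    exact ht.2
  rw [this, zero_add]

theorem exists_truncSum_generator (hs : 0 < xstar) (hκ : κ ∈ Set.Ioo (0 : ℝ) 1) {lam r : ℝ}
    (hr : r ≠ 0) {Pu Pv : ℝ → ℂ} {c : ℂ} (hc : c = ((lam * (1 - κ) / (r * κ) : ℝ) : ℂ))
    (hu : SolvesSystem xstar (lam / r) c u Pu 0) (hv : SolvesSystem xstar (lam / r) c v Pv 0)
    (hW : ∀ x > (0 : ℝ), u x * deriv v x - deriv u x * v x ≠ 0)
    (hv0 : Tendsto v (𝓝[>] 0) (𝓝 0)) (hPv0 : Tendsto Pv (𝓝[>] 0) (𝓝 0)) (n : ℕ) :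
    Continuous (truncSum xstar κ c u v n) ∧ ∃ P : ℝ → ℂ, ∀ x : ℝ, 0 < x →
      HasDerivAt (truncSum xstar κ c u v (n + 1)) (P x / ((x * (x + xstar) : ℝ) : ℂ)) x ∧
      r * P x - lam * (x + xstar) * truncSum xstar κ c u v (n + 1) x +
        lam / κ * ∫ t in (0 : ℝ)..x, truncSum xstar κ c u v (n + 1) t =
        lam / κ * ∫ t in (0 : ℝ)..lmap xstar κ x, truncSum xstar κ c u v n t := by
  obtain ⟨⟨P₀, hP₀, hP₀0⟩, hP, hcont⟩ := exists_solvesSystem_truncT hs hκ hu hv hW hv0 hPv0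
  have hcs : ∀ n, Continuous (truncSum xstar κ c u v n) := fun n =>
    continuous_finsetSum _ fun i _ => (hcont i).const_mul _
  have hT0 : ∀ j, ∀ x ≤ 0, truncT xstar κ u v j x = 0 := fun j x hx =>
    truncT_of_le u v (hx.trans (xpt_nonneg hs hκ j))
  have hr' : (r : ℂ) ≠ 0 := Complex.ofReal_ne_zero.2 hr
  have hκ' : (κ : ℂ) ≠ 0 := Complex.ofReal_ne_zero.2 hκ.1.ne'
  have hκ1 : (1 : ℂ) - κ ≠ 0 := by
    have := Complex.ofReal_ne_zero.2 (sub_pos.2 hκ.2).ne'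
    simpa using this
  refine ⟨hcs n, ?_⟩
  induction n with
  | zero =>
    have e1 : truncSum xstar κ c u v 1 = truncT xstar κ u v 0 := by
      funext x
      simp [truncSum]
    refine ⟨P₀, fun x hx => ?_⟩
    rw [zero_add, e1]
    refine ⟨(hP₀ x hx).1, ?_⟩
    have := (hc ▸ hP₀).integral_eq hs hr hκ.1.ne' (hcont 0) continuous_const (hT0 0 0 le_rfl)
      hP₀0 hx
    simpa [truncSum] using this
  | succ n ih =>
    obtain ⟨P, hP'⟩ := ih
    obtain ⟨Q, hQ, hQ0⟩ := hP n
    refine ⟨fun x => P x + c ^ (n + 1) * Q x, fun x hx => ?_⟩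
    obtain ⟨h1, h2⟩ := hP' x hx
    have e2 : truncSum xstar κ c u v (n + 1 + 1) = fun x => truncSum xstar κ c u v (n + 1) x +
        c ^ (n + 1) * truncT xstar κ u v (n + 1) x := funext (truncSum_succ c (n + 1))
    constructor
    · rw [e2]
      refine (h1.add ((hQ x hx).1.const_mul (c ^ (n + 1)))).congr_deriv ?_
      ring
    · have h3 := (hc ▸ hQ).integral_eq hs hr hκ.1.ne' (hcont (n + 1))
        ((hcont n).comp (by unfold lmap; fun_prop)) (hT0 (n + 1) 0 le_rfl) hQ0 hx
      rw [integral_comp_lmap_of_nonpos hs hκ (hcont n) (hT0 n)] at h3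
      have i1 : ∫ t in (0 : ℝ)..x, truncSum xstar κ c u v (n + 1 + 1) t =
          (∫ t in (0 : ℝ)..x, truncSum xstar κ c u v (n + 1) t) +
          c ^ (n + 1) * ∫ t in (0 : ℝ)..x, truncT xstar κ u v (n + 1) t := by
        rw [e2, intervalIntegral.integral_add ((hcs _).intervalIntegrable _ _)
          (((hcont _).const_mul _).intervalIntegrable _ _), intervalIntegral.integral_const_mul]
      have i2 : ∫ t in (0 : ℝ)..lmap xstar κ x, truncSum xstar κ c u v (n + 1) t =
          (∫ t in (0 : ℝ)..lmap xstar κ x, truncSum xstar κ c u v n t) +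
          c ^ n * ∫ t in (0 : ℝ)..lmap xstar κ x, truncT xstar κ u v n t := by
        simp only [truncSum_succ]
        rw [intervalIntegral.integral_add ((hcs _).intervalIntegrable _ _)
          (((hcont _).const_mul _).intervalIntegrable _ _), intervalIntegral.integral_const_mul]
      have hrc : (r : ℂ) * c * (1 - κ : ℂ)⁻¹ = lam / κ := by
        rw [hc]
        push_cast
        field_simp
      rw [i1, i2, truncSum_succ c (n + 1)]
      push_cast at h3 ⊢
      rw [pow_succ]
      linear_combination h2 + c ^ n * c * h3 +
        (c ^ n * ∫ t in (0 : ℝ)..lmap xstar κ x, truncT xstar κ u v n t) * hrc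

end renewal

/-- Theorem 4.1: under the insured net profit condition
`r/λ > 1 + ((1−κ)/κ)log(1−κ)` and `0 < λ/r < 1`, the piecewise function
`h(x̃) = 1 + A·y_j(x̃)` for `x̃ ∈ [x̃_j, x̃_{j+1})`, built from the fundamental solutions
`u, v` (with nonvanishing Wronskian) of `ℒ[y] = 0`, satisfies the infinitesimal generator
equation of the insured process on both regions (away from the interval endpoints) and
`h(x̃) → 1` as `x̃ → 0⁺`. -/
theorem stmt19 (xstar κ lam r : ℝ) (hxstar : 0 < xstar) (hκ : κ ∈ Set.Ioo (0:ℝ) 1)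
    (hlam : 0 < lam) (hr : 0 < r) (hlr : lam / r < 1)
    (hnet : r / lam > 1 + ((1 - κ) / κ) * Real.log (1 - κ))
    (a1 : ℂ)
    (ha1 : a1 = (1 / 2) * (1 - (lam / r : ℝ)) +
      (1 / 2) * (((1 + lam / r) ^ 2 - 4 * lam / (r * κ) : ℝ) : ℂ) ^ ((1:ℂ) / 2))
    (u v : ℝ → ℂ)
    (hu : ∀ x > (0:ℝ), u x =
      ((1 + x / xstar : ℝ) : ℂ) ^ (-a1) *
        hyp2F1C a1 a1 (1 - (lam / r : ℝ)) ((x / (x + xstar) : ℝ) : ℂ))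
    (hv : ∀ x > (0:ℝ), v x =
      ((x / (x + xstar) : ℝ) : ℂ) ^ ((lam / r : ℝ) : ℂ) *
        ((1 + x / xstar : ℝ) : ℂ) ^ (-a1) *
        hyp2F1C ((lam / r : ℝ) + a1) ((lam / r : ℝ) + a1) (1 + (lam / r : ℝ))
          ((x / (x + xstar) : ℝ) : ℂ))
    (hW : ∀ x > (0:ℝ), u x * deriv v x - deriv u x * v x ≠ 0)
    (A : ℂ) (h : ℝ → ℂ)
    (hh : ∀ j : ℕ, ∀ x ∈ Set.Ico (xpt xstar κ j) (xpt xstar κ (j + 1)),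
      h x = 1 + A * yrec xstar κ ((lam * (1 - κ) / (r * κ) : ℝ) : ℂ) u v j x) :
    (∀ x : ℝ, xstar * κ / (1 - κ) < x → (∀ j : ℕ, x ≠ xpt xstar κ j) →
        ((r * (x + xstar) * x : ℝ) : ℂ) * deriv h x -
            ((lam * (x + xstar) : ℝ) : ℂ) * h x +
            ((lam / κ : ℝ) : ℂ) *
              ∫ w in ((x + xstar) * (1 - κ))..(x + xstar), h (w - xstar) = 0) ∧
    (∀ x : ℝ, 0 < x → x < xstar * κ / (1 - κ) →
        ((r * (x + xstar) * x : ℝ) : ℂ) * deriv h x -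
            ((lam * (x + xstar) : ℝ) : ℂ) * h x +
            ((lam / κ : ℝ) : ℂ) * (∫ w in xstar..(x + xstar), h (w - xstar)) +
            ((lam * xstar : ℝ) : ℂ) - ((lam * (1 - κ) * x / κ : ℝ) : ℂ) = 0) ∧
    Filter.Tendsto h (nhdsWithin 0 (Set.Ioi 0)) (nhds 1) := by
  have hκ0 : κ ≠ 0 := hκ.1.ne'
  have h1κ : 0 < 1 - κ := sub_pos.2 hκ.2
  set q : ℝ := lam / r with hq
  have hq0 : 0 < q := div_pos hlam hr
  set c : ℂ := ((lam * (1 - κ) / (r * κ) : ℝ) : ℂ) with hc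
  have hquad : a1 ^ 2 - a1 * (1 - q) + c = 0 := by
    set D : ℂ := (((1 + q) ^ 2 - 4 * lam / (r * κ) : ℝ) : ℂ) with hD
    have hsq : (D ^ ((1 : ℂ) / 2)) ^ 2 = D := by
      rw [one_div]
      exact Complex.cpow_ofNat_inv_pow D 2
    have hDc : D = (1 + q) ^ 2 - 4 * (c + q) := by
      rw [hD, hc, hq]
      push_cast
      have e1 : (r : ℂ) ≠ 0 := Complex.ofReal_ne_zero.2 hr.ne'
      have e2 : (κ : ℂ) ≠ 0 := Complex.ofReal_ne_zero.2 hκ0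
      field_simp
      ring
    rw [ha1]
    linear_combination (1 / 4) * hsq + (1 / 4) * hDc
  have hγu : ∀ n : ℕ, 1 - (q : ℂ) + 2 * 0 + n ≠ 0 := fun n => by
    have : (1 - q + n : ℝ) ≠ 0 := by
      have := n.cast_nonneg (α := ℝ)
      linarith
    simpa using Complex.ofReal_ne_zero.2 this
  have hγv : ∀ n : ℕ, 1 - (q : ℂ) + 2 * q + n ≠ 0 := fun n => by
    have : (1 - q + 2 * q + n : ℝ) ≠ 0 := by
      have := n.cast_nonneg (α := ℝ)
      linarith
    simpa using Complex.ofReal_ne_zero.2 this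
  obtain ⟨Pu, hPu, -⟩ := exists_solvesSystem_hyp2F1C (y := u) hxstar (μ := 0) (by ring) hquad hγu
    fun x hx => by simpa using hu x hx
  obtain ⟨Pv, hPv, hv0⟩ := exists_solvesSystem_hyp2F1C (y := v) hxstar (μ := q) (by ring) hquad hγv
    fun x hx => by
      rw [hv x hx, show (1 : ℂ) - q + 2 * q = 1 + q by ring]
  obtain ⟨hv0, hPv0⟩ := hv0 (by simpa using hq0)
  have hgen := exists_truncSum_generator hxstar hκ hr.ne' hc hPu hPv hW hv0 hPv0
  set Y := truncSum xstar κ c u v with hY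
  have hhY : ∀ n : ℕ, ∀ t : ℝ, 0 < t → t < xpt xstar κ n → h t = 1 + A * Y n t := by
    intro n t ht htn
    obtain ⟨j, hj⟩ := exists_mem_Ico_xpt hxstar hκ ht.le
    have hjn : j + 1 ≤ n := (xpt_strictMono hxstar hκ).lt_iff_lt.1 (hj.1.trans_lt htn)
    rw [hh j t hj, yrec_eq_truncSum hxstar hκ c j ht hj.1, hY,
      truncSum_eq_of_le hxstar hκ c hjn hj.2.le]
  have hx1 : 0 < xpt xstar κ 1 := xpt_strictMono hxstar hκ Nat.zero_lt_one
  have hY0 : ∀ n : ℕ, ∀ x ≤ 0, Y n x = 0 := fun n x hx => truncSum_of_nonpos hxstar hκ c n hx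
  have hint : ∀ n : ℕ, ∀ a b : ℝ, 0 ≤ a → a ≤ b → b < xpt xstar κ n →
      ∫ t in a..b, h t = (b - a) + A * ((∫ t in (0 : ℝ)..b, Y n t) - ∫ t in (0 : ℝ)..a, Y n t) := by
    intro n a b ha hab hbn
    have hYi : ∀ a b : ℝ, IntervalIntegrable (Y n) volume a b := fun a b =>
      (hgen n).1.intervalIntegrable a b
    have e : ∫ t in a..b, h t = ∫ t in a..b, (1 + A * Y n t) := by
      rw [intervalIntegral.integral_of_le hab, intervalIntegral.integral_of_le hab]
      exact setIntegral_congr_fun measurableSet_Ioc fun t ht =>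
        hhY n t (ha.trans_lt ht.1) (ht.2.trans_lt hbn)
    rw [e, intervalIntegral.integral_add (intervalIntegrable_const) ((hYi a b).const_mul A),
      intervalIntegral.integral_const_mul, intervalIntegral.integral_interval_sub_left (hYi _ _)
      (hYi _ _), intervalIntegral.integral_const]
    simp
  have hmain : ∀ x : ℝ, 0 < x → ∃ n : ℕ, x < xpt xstar κ (n + 1) ∧
      ((r * (x + xstar) * x : ℝ) : ℂ) * deriv h x - ((lam * (x + xstar) : ℝ) : ℂ) * h x =
        A * (lam / κ) * ((∫ t in (0 : ℝ)..lmap xstar κ x, Y (n + 1) t) -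
          ∫ t in (0 : ℝ)..x, Y (n + 1) t) - lam * (x + xstar) := by
    intro x hx
    obtain ⟨n, hn⟩ := exists_lt_xpt_succ hxstar hκ x
    refine ⟨n, hn, ?_⟩
    obtain ⟨P, hP⟩ := (hgen n).2
    obtain ⟨hd, hE⟩ := hP x hx
    have hdh : HasDerivAt h (A * (P x / ((x * (x + xstar) : ℝ) : ℂ))) x := by
      refine ((hd.const_mul A).const_add 1).congr_of_eventuallyEq ?_
      filter_upwards [Ioo_mem_nhds hx hn] with t ht using hhY _ t ht.1 ht.2
    have el : ∫ t in (0 : ℝ)..lmap xstar κ x, Y (n + 1) t =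
        ∫ t in (0 : ℝ)..lmap xstar κ x, Y n t := by
      refine intervalIntegral.integral_congr fun t ht => ?_
      refine truncSum_eq_of_le hxstar hκ c n.le_succ (ht.2.trans (max_le ?_ ?_))
      · exact xpt_nonneg hxstar hκ n
      · exact ((lmap_lt_xpt_iff hκ.2).2 hn).le
    rw [hdh.deriv, hhY _ x hx hn, el]
    have e1 : (x : ℂ) ≠ 0 := Complex.ofReal_ne_zero.2 hx.ne'
    have e3 : (x : ℂ) + xstar ≠ 0 := by
      rw [← Complex.ofReal_add]; exact Complex.ofReal_ne_zero.2 (by positivity)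
    have ep : ((r * (x + xstar) * x : ℝ) : ℂ) * (A * (P x / ((x * (x + xstar) : ℝ) : ℂ))) =
        A * (r * P x) := by
      push_cast
      field_simp
    rw [ep]
    push_cast
    linear_combination A * hE
  have hκc : (κ : ℂ) ≠ 0 := Complex.ofReal_ne_zero.2 hκ0
  have hx1' : xpt xstar κ 1 = xstar * κ / (1 - κ) := by simp [xpt]
  refine ⟨fun x hx _ => ?_, fun x hx hx' => ?_, ?_⟩
  · rw [← hx1'] at hx
    obtain ⟨n, hn, hE⟩ := hmain x (hx1.trans hx)
    have hl0 : 0 < lmap xstar κ x := by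
      have := lmap_strictMono (xstar := xstar) hκ.2 hx
      rwa [lmap_xpt_succ hκ.2] at this
    have hlx : lmap xstar κ x ≤ x := by
      have h1 := mul_pos hxstar hκ.1
      have h2 := mul_pos hκ.1 (hx1.trans hx)
      unfold lmap
      linarith
    rw [hE, intervalIntegral.integral_comp_sub_right,
      show (x + xstar) * (1 - κ) - xstar = lmap xstar κ x by unfold lmap; ring, add_sub_cancel_right,
      hint (n + 1) _ _ hl0.le hlx hn]
    unfold lmap
    push_cast
    field_simp
    ring
  · rw [← hx1'] at hx'
    obtain ⟨n, hn, hE⟩ := hmain x hx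
    have hl0 : lmap xstar κ x ≤ 0 := (lmap_le_xpt_iff (j := 0) hκ.2).2 hx'.le
    have hz : ∫ t in (0 : ℝ)..lmap xstar κ x, Y (n + 1) t = 0 := by
      refine (intervalIntegral.integral_congr (g := fun _ => 0) fun t ht => hY0 _ t ?_).trans
        intervalIntegral.integral_zero
      exact ht.2.trans (max_le le_rfl hl0)
    rw [hE, hz, intervalIntegral.integral_comp_sub_right, sub_self, add_sub_cancel_right,
      hint (n + 1) 0 x le_rfl hx.le hn, intervalIntegral.integral_same]
    push_cast
    field_simp
    ring
  · have hlim : Tendsto (fun t => 1 + A * Y 1 t) (𝓝[>] 0) (𝓝 1) := by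
      have := (((hgen 1).1.const_mul A).const_add 1).tendsto 0
      rw [hY0 1 0 le_rfl] at this
      simpa using this.mono_left (nhdsWithin_le_nhds (s := Set.Ioi (0 : ℝ)))
    refine hlim.congr' ?_
    filter_upwards [Ioo_mem_nhdsGT hx1] with t ht using (hhY 1 t ht.1 ht.2).symm
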